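/- For any real numbers p, q with 0 ≤ p < q ≤ 1, there exists a precise forecasting system φ with φ(s) ⊆ [p,q] for all s ∈ 𝕊 such that, for every path ω ∈ Ω, ω is C-random for φ if and only if ω is C-random for the stationary interval forecast [p,q]. -/

import Mathlib

open Filter Classical

/-- Situations: finite binary strings. -/
abbrev Situation := List Bool

/-- Paths: infinite binary sequences. -/
abbrev BinPath := ℕ → Bool

/-- The length-`n` prefix `ω_{1:n}` of a path. -/
def pref (ω : BinPath) (n : ℕ) : Situation := List.ofFn (fun i : Fin n => ω i)

/-- The real value of a bit. -/
def bit (x : Bool) : ℝ := if x then 1 else 0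

/-- Local expectation `E_p(f) = p f(1) + (1-p) f(0)` of a gamble `f : Bool → ℝ`. -/
def localE (p : ℝ) (f : Bool → ℝ) : ℝ := p * f true + (1 - p) * f false

/-- Upper expectation of a gamble for interval forecast `[lo, hi]`. -/
def upperE (lo hi : ℝ) (f : Bool → ℝ) : ℝ := max (localE lo f) (localE hi f)

/-- A forecasting system, given by lower and upper bounds `lo hi : Situation → ℝ`,
is proper when `0 ≤ lo s ≤ hi s ≤ 1` everywhere. -/
def IsForecastingSystem (lo hi : Situation → ℝ) : Prop :=
  ∀ s, 0 ≤ lo s ∧ lo s ≤ hi s ∧ hi s ≤ 1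

/-- The process difference `ΔF(s) : x ↦ F(s·x) − F(s)`. -/
def diffP (F : Situation → ℝ) (s : Situation) : Bool → ℝ := fun x => F (s ++ [x]) - F s

/-- A supermartingale for the forecasting system `(lo, hi)`. -/
def IsSupermartingale (lo hi : Situation → ℝ) (F : Situation → ℝ) : Prop :=
  ∀ s, upperE (lo s) (hi s) (diffP F s) ≤ 0

/-- A test supermartingale: a nonnegative supermartingale starting at 1. -/
def IsTestSupermartingale (lo hi : Situation → ℝ) (F : Situation → ℝ) : Prop :=
  IsSupermartingale lo hi F ∧ (∀ s, 0 ≤ F s) ∧ F [] = 1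

/-- A real process is (positive) rational-valued and recursive. -/
def IsRecursiveRational (F : Situation → ℝ) : Prop :=
  ∃ q : Situation → ℚ, Computable q ∧ ∀ s, (q s : ℝ) = F s

/-- A real process is computable. -/
def IsComputableProcess (F : Situation → ℝ) : Prop :=
  ∃ q : Situation → ℕ → ℚ, Computable₂ q ∧
    ∀ s n, |F s - q s n| < (2 : ℝ) ^ (-(n : ℤ))

/-- A real process is lower semicomputable. -/
def IsLSCProcess (F : Situation → ℝ) : Prop :=
  ∃ q : Situation → ℕ → ℚ, Computable₂ q ∧
    (∀ s n, q s n ≤ q s (n + 1)) ∧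
    ∀ s, Tendsto (fun m => (q s m : ℝ)) atTop (nhds (F s))

/-- A (real) growth function: computable, nonnegative, nondecreasing and unbounded. -/
def IsGrowthFunction (τ : ℕ → ℝ) : Prop :=
  (∀ n, 0 ≤ τ n) ∧ (∀ n, τ n ≤ τ (n + 1)) ∧ Tendsto τ atTop atTop ∧
    ∃ q : ℕ → ℕ → ℚ, Computable₂ q ∧ ∀ n m, |τ n - q n m| < (2 : ℝ) ^ (-(m : ℤ))

/-- A real process is unbounded on a path: `limsup_n T(ω_{1:n}) = ∞`. -/
def UnboundedOn (T : Situation → ℝ) (ω : BinPath) : Prop :=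
  limsup (fun n => ((T (pref ω n) : ℝ) : EReal)) atTop = ⊤

/-- A real process is computably unbounded on a path:
`limsup_n [T(ω_{1:n}) − τ(n)] ≥ 0` for some growth function `τ`. -/
def ComputablyUnboundedOn (T : Situation → ℝ) (ω : BinPath) : Prop :=
  ∃ τ : ℕ → ℝ, IsGrowthFunction τ ∧
    0 ≤ limsup (fun n => ((T (pref ω n) - τ n : ℝ) : EReal)) atTop

/-- Computable randomness for the forecasting system `(lo, hi)`:
no recursive positive rational test supermartingale is unbounded on `ω`. -/
def CRandom (lo hi : Situation → ℝ) (ω : BinPath) : Prop :=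
  ∀ T : Situation → ℝ, IsRecursiveRational T → (∀ s, 0 < T s) →
    IsTestSupermartingale lo hi T → ¬ UnboundedOn T ω

/-- Schnorr randomness for the forecasting system `(lo, hi)`:
no recursive positive rational test supermartingale is computably unbounded on `ω`. -/
def SchnorrRandom (lo hi : Situation → ℝ) (ω : BinPath) : Prop :=
  ∀ T : Situation → ℝ, IsRecursiveRational T → (∀ s, 0 < T s) →
    IsTestSupermartingale lo hi T → ¬ ComputablyUnboundedOn T ω

/-- Martin-Löf randomness for the forecasting system `(lo, hi)`:
no lower semicomputable test supermartingale is unbounded on `ω`. -/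
def MLRandom (lo hi : Situation → ℝ) (ω : BinPath) : Prop :=
  ∀ T : Situation → ℝ, IsLSCProcess T →
    IsTestSupermartingale lo hi T → ¬ UnboundedOn T ω

/-- A selection process is temporal if its value depends only on the length. -/
def IsTemporal (S : Situation → Bool) : Prop :=
  ∀ s t : Situation, s.length = t.length → S s = S t

/-- Value of a selection process along a path. -/
def selVal (S : Situation → Bool) (ω : BinPath) (k : ℕ) : ℝ := if S (pref ω k) then 1 else 0

/-- `ω` is `𝒮`-random for the forecasting system `(lo, hi)`. -/
def SSetRandom (𝒮 : Set (Situation → Bool)) (lo hi : Situation → ℝ) (ω : BinPath) : Prop :=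
  ∀ S ∈ 𝒮,
    Tendsto (fun n => ∑ k ∈ Finset.range n, selVal S ω k) atTop atTop →
      0 ≤ liminf (fun n =>
          (((∑ k ∈ Finset.range n, selVal S ω k * (bit (ω k) - lo (pref ω k))) /
              (∑ k ∈ Finset.range n, selVal S ω k) : ℝ) : EReal)) atTop ∧
        limsup (fun n =>
          (((∑ k ∈ Finset.range n, selVal S ω k * (bit (ω k) - hi (pref ω k))) /
              (∑ k ∈ Finset.range n, selVal S ω k) : ℝ) : EReal)) atTop ≤ 0

/-- Weak Church randomness: the selection-process conditions hold for all
recursive temporal selection processes. -/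
def WCHRandom (lo hi : Situation → ℝ) (ω : BinPath) : Prop :=
  SSetRandom {S | Computable S ∧ IsTemporal S} lo hi ω

/-- Global upper expectation of a bounded global gamble `f : BinPath → ℝ`. -/
noncomputable def globalUpperE (lo hi : Situation → ℝ) (f : BinPath → ℝ) : ℝ :=
  sInf {m : ℝ | ∃ M : Situation → ℝ, IsSupermartingale lo hi M ∧ M [] = m ∧
    ∀ ω : BinPath, (f ω : EReal) ≤ liminf (fun n => ((M (pref ω n) : ℝ) : EReal)) atTop}

/-- Upper probability of an event. -/
noncomputable def upperProb (lo hi : Situation → ℝ) (A : Set BinPath) : ℝ :=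
  globalUpperE lo hi (Set.indicator A 1)

/-- An event is almost sure if its complement has upper probability zero. -/
def AlmostSure (lo hi : Situation → ℝ) (A : Set BinPath) : Prop :=
  upperProb lo hi Aᶜ = 0

/-- The set of recursive positive rational test processes `𝓕_C`. -/
def FsetC : Set (Situation → ℝ) :=
  {F | IsRecursiveRational F ∧ (∀ s, 0 < F s) ∧ F [] = 1}

/-- The set of lower semicomputable test processes `𝓕_ML`. -/
def FsetML : Set (Situation → ℝ) :=
  {F | IsLSCProcess F ∧ (∀ s, 0 ≤ F s) ∧ F [] = 1}

/-- The temporal selection process `S^r_F` associated with a real process `F`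
and a number `r`. -/
noncomputable def selProc (r : ℝ) (F : Situation → ℝ) : Situation → Bool := fun s =>
  if ∃ t : Situation, t.length = s.length ∧ 0 < localE r (diffP F t) then true else false

/-- The set of selection processes `𝒮^{p,q}_𝓕`. -/
def SelSet (p q : ℝ) (𝓕 : Set (Situation → ℝ)) : Set (Situation → Bool) :=
  {S | ∃ F ∈ 𝓕, ∃ r ∈ ({p, q} : Set ℝ), S = selProc r F}

/-- The temporal precise forecasting system `φ^ϖ_{p,q}`. -/
def tempFS (p q : ℝ) (ϖ : BinPath) : Situation → ℝ := fun s => if ϖ s.length then q else p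

/-- A test process `F` is generated by the multiplier process `D`. -/
def GeneratedBy (D : Situation → Bool → ℝ) (F : Situation → ℝ) : Prop :=
  F [] = 1 ∧ ∀ s x, F (s ++ [x]) = F s * D s x

/-- A lower semicomputable multiplier process: a nonnegative gamble process that
is lower semicomputable. -/
def IsLSCMultiplier (D : Situation → Bool → ℝ) : Prop :=
  (∀ s x, 0 ≤ D s x) ∧
  ∃ q : Situation → Bool → ℕ → ℚ,
    Computable (fun p : Situation × Bool × ℕ => q p.1 p.2.1 p.2.2) ∧
    (∀ s x n, q s x n ≤ q s x (n + 1)) ∧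
    ∀ s x, Tendsto (fun m => (q s x m : ℝ)) atTop (nhds (D s x))

theorem computable_of_graph {α : Type*} [Primcodable α] (f : α → ℕ) (g : α → ℕ → Bool)
    (hg : Computable₂ g) (h : ∀ a n, g a n = true ↔ f a = n) : Computable f := by
  have h1 : Partrec fun a => Nat.rfind (fun n => (Part.some (g a n) : Part Bool)) :=
    Partrec.rfind (p := fun a n => Part.some (g a n)) hg
  refine h1.of_eq fun a => ?_
  apply Part.eq_some_iff.2
  refine Nat.mem_rfind.2 ⟨by simp [(h a _).2 rfl], fun {m} hm => ?_⟩
  simp only [Part.mem_some_iff]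
  by_contra hc
  have : g a m = true := by cases hh : g a m <;> simp_all
  have := (h a m).1 this
  lia

/-- the underlying code of a rational -/
def ratCode (x : ℚ) : ℕ := Nat.pair (Equiv.intEquivNat x.num) x.den

def IsRatCode (n : ℕ) : Prop :=
  0 < n.unpair.2 ∧ ∀ k < n.unpair.2 + 1, (n.unpair.1 + 1) / 2 % k = 0 → n.unpair.2 % k = 0 → k = 1

theorem intCode_natAbs (z : ℤ) : (Equiv.intEquivNat z + 1) / 2 = z.natAbs := by
  rcases z with a | a
  · show (2 * a + 1) / 2 = a
    lia
  · show (2 * a + 1 + 1) / 2 = a + 1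
    lia

theorem intCode_nonneg (z : ℤ) : (Equiv.intEquivNat z) % 2 = 0 ↔ 0 ≤ z := by
  rcases z with a | a
  · show (2 * a) % 2 = 0 ↔ 0 ≤ (a : ℤ)
    lia
  · show (2 * a + 1) % 2 = 0 ↔ _
    have := Int.negSucc_lt_zero a
    lia

theorem isRatCode_iff (n : ℕ) : IsRatCode n ↔ ∃ x, ratCode x = n := by
  unfold IsRatCode
  constructor
  · rintro ⟨h1, h2⟩
    have hz := intCode_natAbs (Equiv.intEquivNat.symm n.unpair.1)
    rw [Equiv.apply_symm_apply] at hz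
    rw [hz] at h2
    refine ⟨⟨Equiv.intEquivNat.symm n.unpair.1, n.unpair.2, h1.ne', ?_⟩, ?_⟩
    · refine h2 _ ?_ ?_ ?_
      · have := Nat.gcd_le_right (Equiv.intEquivNat.symm n.unpair.1).natAbs h1
        lia
      · exact Nat.mod_eq_zero_of_dvd (Nat.gcd_dvd_left _ _)
      · exact Nat.mod_eq_zero_of_dvd (Nat.gcd_dvd_right _ _)
    · simp [ratCode]
  · rintro ⟨x, rfl⟩
    simp only [ratCode, Nat.unpair_pair]
    refine ⟨x.den_pos, fun k _ h1 h2 => ?_⟩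
    rw [intCode_natAbs] at h1
    exact Nat.eq_one_of_dvd_coprimes x.reduced (Nat.dvd_of_mod_eq_zero h1) (Nat.dvd_of_mod_eq_zero h2)

theorem primrec_isRatCode : PrimrecPred IsRatCode := by
  have hr : PrimrecRel (fun (k n : ℕ) =>
      ¬ ((n.unpair.1 + 1) / 2 % k = 0) ∨ ¬ (n.unpair.2 % k = 0) ∨ k = 1) := by
    have hu : Primrec (fun n : ℕ × ℕ => n.2.unpair) := Primrec.unpair.comp Primrec.snd
    refine PrimrecPred.or (PrimrecPred.not ?_) (PrimrecPred.or (PrimrecPred.not ?_) ?_)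
    · exact Primrec.eq.comp (Primrec.nat_mod.comp (Primrec.nat_div.comp
        (Primrec.nat_add.comp (Primrec.fst.comp hu) (Primrec.const 1)) (Primrec.const 2))
        Primrec.fst) (Primrec.const 0)
    · exact Primrec.eq.comp (Primrec.nat_mod.comp (Primrec.snd.comp hu) Primrec.fst)
        (Primrec.const 0)
    · exact Primrec.eq.comp Primrec.fst (Primrec.const 1)
  have hu : Primrec (fun n : ℕ => n.unpair.2) := Primrec.snd.comp Primrec.unpair
  have h2 : PrimrecPred (fun n : ℕ => ∀ k < n.unpair.2 + 1,
      ¬ ((n.unpair.1 + 1) / 2 % k = 0) ∨ ¬ (n.unpair.2 % k = 0) ∨ k = 1) :=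
    PrimrecRel.comp (PrimrecRel.forall_lt hr) (Primrec.succ.comp hu) Primrec.id
  have h3 : PrimrecPred (fun n : ℕ => 0 < n.unpair.2) := Primrec.nat_lt.comp (Primrec.const 0) hu
  refine (h3.and h2).of_eq fun n => ?_
  unfold IsRatCode
  refine and_congr Iff.rfl (forall₂_congr fun k _ => ?_)
  tauto

/-- the code of a rational used by `Computable` -/
def ratEnc (x : ℚ) : ℕ := @Encodable.encode ℚ Rat.instDenumerable.toEncodable x

theorem ratEnc_injective : Function.Injective ratEnc :=
  @Encodable.encode_injective ℚ Rat.instDenumerable.toEncodable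

theorem ofNat_ratEnc (x : ℚ) : Denumerable.ofNat ℚ (ratEnc x) = x := Denumerable.ofNat_encode x

theorem ratEnc_ofNat (n : ℕ) : ratEnc (Denumerable.ofNat ℚ n) = n := Denumerable.encode_ofNat n

theorem primrec_ratEnc : Primrec ratEnc := Primrec.encode

theorem ratEnc_eq (x : ℚ) : ratEnc x = Nat.count IsRatCode (ratCode x) := by
  have : ratEnc x = @List.countP ℕ
      (fun n => @decide _ (Encodable.decidableRangeEncode ℚ n))
      (List.range (@Encodable.encode ℚ Rat.instEncodable x)) := rfl
  rw [this, Nat.count_eq_card_filter_range, List.countP_eq_length_filter]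
  have h2 : (fun n => @decide _ (Encodable.decidableRangeEncode ℚ n))
      = fun n => decide (IsRatCode n) := by
    funext n
    simp only [decide_eq_decide]
    exact (isRatCode_iff n).symm
  rw [h2]
  rfl

theorem primrec_count : Primrec (fun n => Nat.count IsRatCode n) := by
  have hd : Primrec (fun n => decide (IsRatCode n)) := primrec_isRatCode.decide
  have : Primrec (fun n : ℕ => (Nat.rec 0 (fun k r => r + bif decide (IsRatCode k) then 1 else 0) n : ℕ)) := by
    refine Primrec.nat_rec₁ 0 (f := fun k r => r + bif decide (IsRatCode k) then 1 else 0) ?_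
    exact Primrec.nat_add.comp Primrec.snd
      (Primrec.cond (hd.comp Primrec.fst) (Primrec.const 1) (Primrec.const 0))
  refine this.of_eq fun n => ?_
  induction n with
  | zero => simp
  | succ n ih => 
    rw [Nat.count_succ, ← ih]
    by_cases h : IsRatCode n <;> simp [h]

theorem computable_ratCode : Computable ratCode := by
  refine computable_of_graph ratCode
    (fun x n => decide (IsRatCode n) && decide (Nat.count IsRatCode n = ratEnc x)) ?_ ?_
  · apply Primrec.to_comp
    refine Primrec.and.comp (primrec_isRatCode.decide.comp Primrec.snd) ?_
    exact (Primrec.eq.comp (primrec_count.comp Primrec.snd)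
      (primrec_ratEnc.comp Primrec.fst)).decide
  · intro x n
    simp only [Bool.and_eq_true, decide_eq_true_eq, ratEnc_eq]
    constructor
    · rintro ⟨h1, h2⟩
      obtain ⟨y, rfl⟩ := (isRatCode_iff n).1 h1
      rw [← ratEnc_eq, ← ratEnc_eq] at h2
      rw [ratEnc_injective h2]
    · rintro rfl
      exact ⟨(isRatCode_iff _).2 ⟨x, rfl⟩, rfl⟩

/-- decidable test for `y = c * x` on codes of nonnegative rationals -/
def scaleTest (cn cd : ℕ) (u : (ℕ × ℕ) × (ℕ × ℕ)) : Bool :=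
  decide (u.1.1 % 2 = 0) && decide ((u.1.1 + 1) / 2 * (u.2.2 * cd) =
    cn * ((u.2.1 + 1) / 2 * u.1.2))

theorem primrec_scaleTest (cn cd : ℕ) : Primrec (scaleTest cn cd) := by
  have a11 : Primrec (fun u : (ℕ × ℕ) × (ℕ × ℕ) => u.1.1) := Primrec.fst.comp Primrec.fst
  have a12 : Primrec (fun u : (ℕ × ℕ) × (ℕ × ℕ) => u.1.2) := Primrec.snd.comp Primrec.fst
  have a21 : Primrec (fun u : (ℕ × ℕ) × (ℕ × ℕ) => u.2.1) := Primrec.fst.comp Primrec.snd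
  have a22 : Primrec (fun u : (ℕ × ℕ) × (ℕ × ℕ) => u.2.2) := Primrec.snd.comp Primrec.snd
  refine Primrec.and.comp ?_ ?_
  · exact (Primrec.eq.comp (Primrec.nat_mod.comp a11 (Primrec.const 2))
      (Primrec.const 0)).decide
  · exact (Primrec.eq.comp
      (Primrec.nat_mul.comp (Primrec.nat_div.comp (Primrec.succ.comp a11) (Primrec.const 2))
        (Primrec.nat_mul.comp a22 (Primrec.const _)))
      (Primrec.nat_mul.comp (Primrec.const _) (Primrec.nat_mul.comp
        (Primrec.nat_div.comp (Primrec.succ.comp a21) (Primrec.const 2)) a12))).decide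

theorem rat_eq_natAbs_div {x : ℚ} (h : 0 ≤ x.num) : x = (x.num.natAbs : ℚ) / x.den := by
  rw [Nat.cast_natAbs, abs_of_nonneg h, Rat.num_div_den]

theorem computable_scale {α : Type*} [Primcodable α] (T : α → ℚ) (hT : Computable T)
    (hpos : ∀ s, 0 < T s) (c : ℚ) (hc : 0 < c) : Computable (fun s => c * T s) := by
  have key : Computable (fun s => ratEnc (c * T s)) := by
    refine computable_of_graph _ (fun s n => scaleTest c.num.natAbs c.den
      ((ratCode (Denumerable.ofNat ℚ n)).unpair, (ratCode (T s)).unpair)) ?_ ?_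
    · have e1 : Computable (fun a : α × ℕ => (ratCode (Denumerable.ofNat ℚ a.2)).unpair) :=
        Computable.unpair.comp (computable_ratCode.comp ((Computable.ofNat ℚ).comp Computable.snd))
      have e2 : Computable (fun a : α × ℕ => (ratCode (T a.1)).unpair) :=
        Computable.unpair.comp (computable_ratCode.comp (hT.comp Computable.fst))
      exact (primrec_scaleTest c.num.natAbs c.den).to_comp.comp (e1.pair e2)
    · intro s n
      obtain ⟨y, rfl⟩ : ∃ y : ℚ, ratEnc y = n := ⟨Denumerable.ofNat ℚ n, ratEnc_ofNat n⟩
      rw [ratEnc_injective.eq_iff]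
      simp only [scaleTest, ofNat_ratEnc, ratCode, Nat.unpair_pair, intCode_natAbs,
        Bool.and_eq_true, decide_eq_true_eq, intCode_nonneg]
      have hTs := hpos s
      generalize T s = x at *
      have hc' : c = (c.num.natAbs : ℚ) / c.den := rat_eq_natAbs_div (Rat.num_pos.2 hc).le
      have hx' : x = (x.num.natAbs : ℚ) / x.den := rat_eq_natAbs_div (Rat.num_pos.2 hTs).le
      have hcd : (c.den : ℚ) ≠ 0 := by exact_mod_cast c.den_nz
      have hxd : (x.den : ℚ) ≠ 0 := by exact_mod_cast x.den_nz
      have hyd : (y.den : ℚ) ≠ 0 := by exact_mod_cast y.den_nz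
      have main : 0 ≤ y.num → (y.num.natAbs * (x.den * c.den) =
          c.num.natAbs * (x.num.natAbs * y.den) ↔ c * x = y) := by
        intro hy
        have hy' : y = (y.num.natAbs : ℚ) / y.den := rat_eq_natAbs_div hy
        have e : c * x = y ↔ (c.num.natAbs : ℚ) / c.den * ((x.num.natAbs : ℚ) / x.den)
            = (y.num.natAbs : ℚ) / y.den := by rw [← hc', ← hx', ← hy']
        rw [e, ← @Nat.cast_inj ℚ]
        push_cast
        field_simp
        constructor <;> intro h <;> linarith
      constructor
      · rintro ⟨h1, h2⟩
        exact (main h1).1 h2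
      · intro h
        have hy : 0 ≤ y.num := by
          rw [Rat.num_nonneg, ← h]; positivity
        exact ⟨hy, (main hy).2 h⟩
  exact ((Computable.ofNat ℚ).comp key).of_eq fun s => ofNat_ratEnc _

theorem unboundedOn_iff (T : Situation → ℝ) (ω : BinPath) :
    UnboundedOn T ω ↔ ∀ B : ℝ, ∃ᶠ n in atTop, B < T (pref ω n) := by
  unfold UnboundedOn
  constructor
  · intro h B
    have : (B : EReal) < limsup (fun n => ((T (pref ω n) : ℝ) : EReal)) atTop := by
      rw [h]; exact EReal.coe_lt_top B
    exact (frequently_lt_of_lt_limsup (by isBoundedDefault) this).mono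
      fun n hn => EReal.coe_lt_coe_iff.1 hn
  · intro h
    rw [EReal.eq_top_iff_forall_lt]
    intro B
    refine lt_of_lt_of_le (EReal.coe_lt_coe_iff.2 (lt_add_one B)) ?_
    exact le_limsup_of_frequently_le ((h (B + 1)).mono fun n hn => EReal.coe_le_coe_iff.2 hn.le)
      (by isBoundedDefault)

theorem countable_recursive : {F : Situation → ℝ | IsRecursiveRational F}.Countable := by
  have h1 : Countable {f : Situation → ℚ // Computable f} := by
    refine @Function.Injective.countable _ {f : ℕ →. ℕ // Partrec f} inferInstance
      (fun f => ⟨fun n => Part.bind (Part.ofOption (Encodable.decode (α := Situation) n))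
        fun a => (Part.some (f.1 a)).map ratEnc,
          Partrec.nat_iff.2 (show Nat.Partrec _ from f.2)⟩) ?_
    intro f g hfg
    apply Subtype.ext
    funext s
    have := congrFun (Subtype.ext_iff.1 hfg) (Encodable.encode s)
    simp at this
    exact ratEnc_injective this
  have h2 : {F : Situation → ℝ | IsRecursiveRational F} ⊆
      Set.range (fun (f : {f : Situation → ℚ // Computable f}) s => ((f.1 s : ℚ) : ℝ)) := by
    rintro F ⟨q, hq, hF⟩
    exact ⟨⟨q, hq⟩, funext hF⟩
  exact (Set.countable_range _).mono h2

/-- Situations where `F` violates the supermartingale condition for `[p,q]`. -/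
def viol (p q : ℝ) (F : Situation → ℝ) : Set Situation :=
  {s | 0 < upperE p q (diffP F s)}

theorem exists_diag (V : ℕ → Set Situation) :
    ∃ σ : ℕ → Situation, ∀ i, (V i).Infinite → σ i ∈ V i ∧ ∀ j < i, σ j ≠ σ i := by
  have hc : ∀ (i : ℕ) (A : Finset Situation), ∃ y, (V i).Infinite → y ∈ V i ∧ y ∉ A := by
    intro i A
    by_cases h : (V i).Infinite
    · obtain ⟨y, hy⟩ := h.exists_notMem_finset A
      exact ⟨y, fun _ => hy⟩
    · exact ⟨[], fun h' => absurd h' h⟩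
  choose c hc using hc
  let A : ℕ → Finset Situation := fun n => Nat.rec ∅ (fun i B => insert (c i B) B) n
  have hA : ∀ i, A (i + 1) = insert (c i (A i)) (A i) := fun i => rfl
  have hmem : ∀ i j, j < i → c j (A j) ∈ A i := by
    intro i
    induction i with
    | zero => intro j hj; lia
    | succ i ih =>
      intro j hj
      rw [hA]
      rcases Nat.lt_succ_iff_lt_or_eq.1 hj with h | h
      · exact Finset.mem_insert_of_mem (ih j h)
      · subst h; exact Finset.mem_insert_self _ _
  refine ⟨fun i => c i (A i), fun i hi => ⟨(hc i (A i) hi).1, fun j hj h => ?_⟩⟩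
  exact (hc i (A i) hi).2 (by
    have h : c j (A j) = c i (A i) := h
    rw [← h]; exact hmem i j hj)

theorem exists_phi (p q : ℝ) (hpq : p < q) : ∃ φ : Situation → ℝ, (∀ s, p ≤ φ s ∧ φ s ≤ q) ∧
    ∀ F, IsRecursiveRational F → IsSupermartingale φ φ F → (viol p q F).Finite := by
  have hne : {F : Situation → ℝ | IsRecursiveRational F}.Nonempty :=
    ⟨fun _ => ((1 : ℚ) : ℝ), fun _ => 1, Computable.const _, fun _ => rfl⟩
  obtain ⟨F, hF⟩ := countable_recursive.exists_eq_range hne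
  obtain ⟨σ, hσ⟩ := exists_diag (fun i => viol p q (F i))
  let φ : Situation → ℝ := fun s =>
    if ∃ i, (viol p q (F i)).Infinite ∧ σ i = s ∧ 0 < localE q (diffP (F i) s) then q else p
  refine ⟨φ, fun s => ?_, fun G hG hs => ?_⟩
  · by_cases h : ∃ i, (viol p q (F i)).Infinite ∧ σ i = s ∧ 0 < localE q (diffP (F i) s)
    · simp only [φ, if_pos h]; exact ⟨hpq.le, le_rfl⟩
    · simp only [φ, if_neg h]; exact ⟨le_rfl, hpq.le⟩
  · obtain ⟨i, rfl⟩ : G ∈ Set.range F := hF ▸ hG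
    by_contra hinf
    have hinf : (viol p q (F i)).Infinite := hinf
    have hv : 0 < upperE p q (diffP (F i) (σ i)) := (hσ i hinf).1
    have hs := hs (σ i)
    simp only [upperE, max_self] at hs hv
    by_cases h : 0 < localE q (diffP (F i) (σ i))
    · have : φ (σ i) = q := if_pos ⟨i, hinf, rfl, h⟩
      rw [this] at hs
      linarith
    · have : φ (σ i) = p := by
        apply if_neg
        rintro ⟨j, hj, hji, hjq⟩
        rcases lt_trichotomy j i with hlt | heq | hlt
        · exact (hσ i hinf).2 j hlt hji
        · subst heq; exact h hjq
        · exact (hσ j hj).2 i hlt hji.symm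
      rw [this] at hs
      rcases lt_max_iff.1 hv with h' | h' <;> linarith

theorem pref_length (ω : BinPath) (n : ℕ) : (pref ω n).length = n := by simp [pref]

theorem pref_take (ω : BinPath) {n m : ℕ} (h : n ≤ m) : (pref ω m).take n = pref ω n := by
  apply List.ext_getElem
  · simp [pref, h]
  · intro i h1 h2
    simp [pref]

theorem computable_modify (r : Situation → ℚ) (hr : Computable r) (hpos : ∀ s, 0 < r s)
    (t : Situation) : Computable (fun s : Situation =>
      if s.take t.length = t then (r t)⁻¹ * r s else 1) := by
  have h1 : Computable (fun s : Situation => decide (s.take t.length = t)) :=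
    ((Primrec.eq.comp (Primrec.list_take.comp (Primrec.const t.length) Primrec.id)
      (Primrec.const t)).decide).to_comp
  refine (Computable.cond h1 (computable_scale r hr hpos (r t)⁻¹ (inv_pos.2 (hpos t)))
    (Computable.const 1)).of_eq fun s => ?_
  by_cases h : s.take t.length = t <;> simp [h]

theorem modify_super (p q : ℝ) (T : Situation → ℝ) (hpos : ∀ s, 0 < T s) (t : Situation)
    (hv : ∀ s ∈ viol p q T, s.length < t.length) :
    IsSupermartingale (fun _ => p) (fun _ => q) (fun s : Situation =>
      if s.take t.length = t then (T t)⁻¹ * T s else 1) := by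
  intro s
  by_cases hlen : t.length ≤ s.length
  · have htake : ∀ x : Bool, (s ++ [x]).take t.length = s.take t.length := fun x =>
      List.take_append_of_le_length hlen
    by_cases h : s.take t.length = t
    · have h2 : ¬ 0 < upperE p q (diffP T s) := fun h' => by
        have := hv s h'
        lia
      have hc : 0 < (T t)⁻¹ := inv_pos.2 (hpos t)
      generalize (T t)⁻¹ = c at *
      simp only [upperE, not_lt, max_le_iff, localE, diffP, htake, h, if_true] at h2 ⊢
      constructor <;> nlinarith [h2.1, h2.2]
    · simp [upperE, localE, diffP, htake, h]
  · have hval : ∀ u : Situation, u.length ≤ t.length →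
        (if u.take t.length = t then (T t)⁻¹ * T u else 1) = 1 := by
      intro u hu
      rw [List.take_of_length_le hu]
      split_ifs with h
      · rw [h]; exact inv_mul_cancel₀ (hpos t).ne'
      · rfl
    have e1 := hval s (by lia)
    have e2 := fun x => hval (s ++ [x]) (by simp; lia)
    simp only [upperE, localE, diffP, e1, e2]
    simp

/-- for `0 ≤ p < q ≤ 1` there is a precise forecasting system `φ`
with `φ(s) ⊆ [p,q]` whose set of C-random paths equals that of the stationary
interval forecast `[p,q]`. -/
theorem statement_3 (p q : ℝ) (h0 : 0 ≤ p) (hpq : p < q) (h1 : q ≤ 1) :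
    ∃ φ : Situation → ℝ, (∀ s, p ≤ φ s ∧ φ s ≤ q) ∧
      ∀ ω : BinPath, CRandom φ φ ω ↔ CRandom (fun _ => p) (fun _ => q) ω := by
  obtain ⟨φ, hφ, hfin⟩ := exists_phi p q hpq
  refine ⟨φ, hφ, fun ω => ⟨fun h T hT hpos hs => h T hT hpos ⟨fun s => ?_, hs.2⟩, ?_⟩⟩
  · have h2 := hs.1 s
    have h3 := hφ s
    simp only [upperE, max_self, max_le_iff, localE] at h2 ⊢
    rcases le_total (diffP T s true) (diffP T s false) with h | h <;> nlinarith [h2.1, h2.2]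
  · intro h T hT hpos hs hub
    obtain ⟨n, hn⟩ : ∃ n, ∀ s ∈ viol p q T, s.length < n := by
      obtain ⟨b, hb⟩ := ((hfin T hT hs.1).image List.length).bddAbove
      exact ⟨b + 1, fun s hs => Nat.lt_succ_of_le (hb ⟨s, hs, rfl⟩)⟩
    obtain ⟨r, hr, hrT⟩ := hT
    have hrpos : ∀ s, 0 < r s := fun s => by
      have := hpos s
      rw [← hrT] at this
      exact_mod_cast this
    have hlen : (pref ω n).length = n := pref_length ω n
    refine h _ ⟨_, computable_modify r hr hrpos (pref ω n), fun s => rfl⟩ ?_ ⟨?_, ?_, ?_⟩ ?_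
    · intro s
      have := mul_pos (inv_pos.2 (hrpos (pref ω n))) (hrpos s)
      split_ifs <;> [exact_mod_cast this; norm_num]
    · have := modify_super p q T hpos (pref ω n) (by rwa [hlen])
      convert this using 2 with s
      rw [← hrT, ← hrT]
      split_ifs <;> push_cast <;> rfl
    · intro s
      have := mul_pos (inv_pos.2 (hrpos (pref ω n))) (hrpos s)
      dsimp only
      split_ifs <;> [exact_mod_cast this.le; norm_num]
    · dsimp only
      rw [List.take_nil]
      split_ifs with hh
      · rw [← hh, inv_mul_cancel₀ (hrpos _).ne']; norm_num
      · norm_num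
    · rw [unboundedOn_iff] at hub ⊢
      intro B
      refine ((hub (T (pref ω n) * B)).and_eventually (eventually_ge_atTop n)).mono ?_
      rintro m ⟨hm, hnm⟩
      rw [hlen, pref_take ω hnm, if_pos rfl]
      push_cast
      rw [hrT, hrT, inv_mul_eq_div, lt_div_iff₀ (hpos _)]
      linarith
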